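/- Let m(omega) = omega^(-theta) for 0 < omega <= 1 and m(omega) = omega^gamma for omega > 1, and suppose -1/2 <= beta <= 0, gamma > 2beta + 2, theta > -2beta - 1. Then the integral over u in (0,1) of (u^(2beta+2)(u+1)^(2beta+2)/(1+u+u^2)^(3beta+4)) * m(omega)^{-1} evaluated at the points omega*u_i (with u1 = (1+u)/(1+u+u^2), u2 = u(1+u)/(1+u+u^2), u3 = u/(1+u+u^2)) times omega^(4beta+3) * m(omega) is bounded uniformly in omega > 0. More precisely, omega^(-theta) * omega^(4beta+3) * integral_0^1 u^(2beta+2) * (u^(2theta) omega^(3theta) + u^theta omega^(3theta)) du <= C * omega^(4beta+3+2theta) <= C for omega <= 1 when 2beta+3+theta > 0, 2beta+3+2theta > 0, and 4beta+3+2theta >= 0. -/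

import Mathlib

open MeasureTheory

/-- The weight `m(ω) = ω^{-θ}` for `ω ≤ 1` and `ω^γ` for `ω > 1`. -/
noncomputable def mmtWeight (θ γ : ℝ) (ω : ℝ) : ℝ :=
  if ω ≤ 1 then ω ^ (-θ) else ω ^ γ

lemma inv_mmtWeight_of_le_one {θ γ x : ℝ} (hx : 0 < x) (hx1 : x ≤ 1) :
    (mmtWeight θ γ x)⁻¹ = x ^ θ := by
  rw [mmtWeight, if_pos hx1, Real.rpow_neg hx.le, inv_inv]

lemma inv_mmtWeight_of_one_lt {θ γ x : ℝ} (hx1 : 1 < x) :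
    (mmtWeight θ γ x)⁻¹ = x ^ (-γ) := by
  rw [mmtWeight, if_neg hx1.not_ge, Real.rpow_neg (by linarith)]

lemma mmtWeight_pos {θ γ x : ℝ} (hx : 0 < x) : 0 < mmtWeight θ γ x := by
  unfold mmtWeight
  split_ifs <;> positivity

lemma rpow_le_three_rpow_abs {t : ℝ} (ht : 1 / 3 ≤ t) (ht1 : t ≤ 1) (s : ℝ) :
    t ^ s ≤ 3 ^ |s| := by
  have h0 : 0 < t := by linarith
  calc t ^ s ≤ t ^ (-|s|) :=
        Real.rpow_le_rpow_of_exponent_ge h0 ht1 (neg_abs_le s)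
    _ ≤ (1 / 3 : ℝ) ^ (-|s|) :=
        Real.rpow_le_rpow_of_nonpos (by norm_num) ht (by simp)
    _ = 3 ^ |s| := by
        rw [one_div, Real.inv_rpow (by norm_num), Real.rpow_neg (by norm_num), inv_inv]

/-- Contracting the argument by a factor in `[1/3, 1]` changes the inverse weight by at most a
constant factor. -/
lemma inv_mmtWeight_mul_le {θ γ t x : ℝ} (hγ : 0 ≤ γ) (ht : 1 / 3 ≤ t) (ht1 : t ≤ 1)
    (hx : 0 < x) :
    (mmtWeight θ γ (t * x))⁻¹ ≤ 3 ^ (|θ| + γ) * (mmtWeight θ γ x)⁻¹ := by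
  have h0 : 0 < t := by linarith
  have htx : 0 < t * x := mul_pos h0 hx
  have hθ1 : (1 : ℝ) ≤ 3 ^ |θ| := Real.one_le_rpow (by norm_num) (abs_nonneg θ)
  have hγ1 : (1 : ℝ) ≤ 3 ^ γ := Real.one_le_rpow (by norm_num) hγ
  rw [Real.rpow_add (by norm_num)]
  rcases le_or_gt x 1 with hx1 | hx1
  · rw [inv_mmtWeight_of_le_one hx hx1,
      inv_mmtWeight_of_le_one htx (mul_le_one₀ ht1 hx.le hx1), Real.mul_rpow h0.le hx.le]
    gcongr
    calc t ^ θ ≤ 3 ^ |θ| := rpow_le_three_rpow_abs ht ht1 θ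
      _ ≤ 3 ^ |θ| * 3 ^ γ := le_mul_of_one_le_right (by positivity) hγ1
  rw [inv_mmtWeight_of_one_lt hx1]
  rcases le_or_gt (t * x) 1 with h | h
  · rw [inv_mmtWeight_of_le_one htx h, mul_assoc]
    have hx3 : x ≤ 3 := by nlinarith
    calc (t * x) ^ θ ≤ 3 ^ |θ| := rpow_le_three_rpow_abs (by nlinarith) h θ
      _ ≤ 3 ^ |θ| * (3 ^ γ * x ^ (-γ)) := by
        refine le_mul_of_one_le_right (by positivity) ?_
        calc (1 : ℝ) = 3 ^ γ * 3 ^ (-γ) := by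
              rw [← Real.rpow_add (by norm_num), add_neg_cancel, Real.rpow_zero]
          _ ≤ 3 ^ γ * x ^ (-γ) := by
              gcongr 3 ^ γ * ?_
              exact Real.rpow_le_rpow_of_nonpos hx hx3 (by linarith)
  · rw [inv_mmtWeight_of_one_lt h, Real.mul_rpow h0.le hx.le]
    gcongr
    calc t ^ (-γ) ≤ 3 ^ |-γ| := rpow_le_three_rpow_abs ht ht1 _
      _ = 3 ^ γ := by rw [abs_neg, abs_of_nonneg hγ]
      _ ≤ 3 ^ |θ| * 3 ^ γ := le_mul_of_one_le_left (by positivity) hθ1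

lemma rpow_scaling {β u ω : ℝ} (hu : 0 < u) (hω : 0 < ω) :
    ω ^ (4*β + 3) * u ^ (2*β + 2) = ω ^ (2*β + 1) * (u * ω) ^ (2*β + 2) := by
  rw [Real.mul_rpow hu.le hω.le, show 4*β + 3 = (2*β + 1) + (2*β + 2) by ring,
    Real.rpow_add hω]
  ring

/-- Products of the inverse weight at `u ω` and at `ω`, with the homogeneous kernel factor. -/
lemma kernel_mul_inv_mmtWeight_mul_le_one {β θ γ u ω : ℝ}
    (hγ : 2*β + 2 < γ) (hθ : -2*β - 1 < θ) (hu : 0 < u) (hu1 : u ≤ 1) (hω : 0 < ω) :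
    ω ^ (4*β + 3) * u ^ (2*β + 2) * ((mmtWeight θ γ (u * ω))⁻¹ * (mmtWeight θ γ ω)⁻¹) ≤ 1 := by
  have hv : 0 < u * ω := mul_pos hu hω
  rcases le_or_gt ω 1 with hω1 | hω1
  · rw [inv_mmtWeight_of_le_one hω hω1, inv_mmtWeight_of_le_one hv (mul_le_one₀ hu1 hω.le hω1),
      Real.mul_rpow hu.le hω.le]
    calc _ = ω ^ (4*β + 3 + θ + θ) * u ^ (2*β + 2 + θ) := by
          rw [Real.rpow_add hω (4*β + 3 + θ), Real.rpow_add hω (4*β + 3),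
            Real.rpow_add hu (2*β + 2)]
          ring
      _ ≤ 1 := mul_le_one₀ (Real.rpow_le_one hω.le hω1 (by linarith)) (by positivity)
          (Real.rpow_le_one hu.le hu1 (by linarith))
  rw [inv_mmtWeight_of_one_lt hω1, rpow_scaling hu hω]
  have hωpow : ω ^ (2*β + 1 + -γ) ≤ 1 :=
    Real.rpow_le_one_of_one_le_of_nonpos hω1.le (by linarith)
  rcases le_or_gt (u * ω) 1 with h | h
  · rw [inv_mmtWeight_of_le_one hv h]
    calc _ = ω ^ (2*β + 1 + -γ) * (u * ω) ^ (2*β + 2 + θ) := by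
          rw [Real.rpow_add hω (2*β + 1), Real.rpow_add hv (2*β + 2)]; ring
      _ ≤ 1 := mul_le_one₀ hωpow (by positivity) (Real.rpow_le_one hv.le h (by linarith))
  · rw [inv_mmtWeight_of_one_lt h]
    calc _ = ω ^ (2*β + 1 + -γ) * (u * ω) ^ (2*β + 2 + -γ) := by
          rw [Real.rpow_add hω (2*β + 1), Real.rpow_add hv (2*β + 2)]; ring
      _ ≤ 1 := mul_le_one₀ hωpow (by positivity)
          (Real.rpow_le_one_of_one_le_of_nonpos h.le (by linarith))

/-- The squared inverse weight at `u ω` is controlled by a profile whose integral over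
`u ∈ (0, 1)` is bounded uniformly in `ω`. -/
lemma kernel_mul_inv_mmtWeight_sq_le {β θ γ δ u ω : ℝ} (hβ₁ : -1/2 ≤ β) (hβ₂ : β ≤ 0)
    (hδ : 0 < δ) (hγ : 4*β + 4 + δ ≤ 2*γ) (hθ : -2*β - 1 < θ) (hu : 0 < u) (hu1 : u ≤ 1)
    (hω : 0 < ω) :
    ω ^ (4*β + 3) * u ^ (2*β + 2) * ((mmtWeight θ γ (u * ω))⁻¹ * (mmtWeight θ γ (u * ω))⁻¹) ≤
      1 + 2 ^ (1 + δ) * (ω * (1 + ω * u) ^ (-δ - 1)) := by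
  have hv : 0 < u * ω := mul_pos hu hω
  have hprofile : 0 ≤ 2 ^ (1 + δ) * (ω * (1 + ω * u) ^ (-δ - 1)) := by positivity
  rcases le_or_gt ω 1 with hω1 | hω1
  · rw [inv_mmtWeight_of_le_one hv (mul_le_one₀ hu1 hω.le hω1), Real.mul_rpow hu.le hω.le]
    refine le_trans ?_ (le_add_of_nonneg_right hprofile)
    calc _ = ω ^ (4*β + 3 + θ + θ) * u ^ (2*β + 2 + θ + θ) := by
          rw [Real.rpow_add hω (4*β + 3 + θ), Real.rpow_add hω (4*β + 3),
            Real.rpow_add hu (2*β + 2 + θ), Real.rpow_add hu (2*β + 2)]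
          ring
      _ ≤ 1 := mul_le_one₀ (Real.rpow_le_one hω.le hω1 (by linarith)) (by positivity)
          (Real.rpow_le_one hu.le hu1 (by linarith))
  refine le_trans ?_ (le_add_of_nonneg_left zero_le_one)
  have hωpow : ω ^ (2*β + 1) ≤ ω := by
    simpa using Real.rpow_le_rpow_of_exponent_le hω1.le (show 2*β + 1 ≤ 1 by linarith)
  have htwo : (2 : ℝ) ^ (1 + δ) * 2 ^ (-δ - 1) = 1 := by
    rw [← Real.rpow_add (by norm_num), show 1 + δ + (-δ - 1) = 0 by ring, Real.rpow_zero]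
  have hcomm : ω * u = u * ω := mul_comm _ _
  suffices hmain : (u * ω) ^ (2*β + 2) *
      ((mmtWeight θ γ (u * ω))⁻¹ * (mmtWeight θ γ (u * ω))⁻¹) ≤
      2 ^ (1 + δ) * (1 + u * ω) ^ (-δ - 1) by
    rw [rpow_scaling hu hω, hcomm, mul_assoc]
    calc _ ≤ ω * (2 ^ (1 + δ) * (1 + u * ω) ^ (-δ - 1)) := by
          refine mul_le_mul hωpow hmain ?_ hω.le
          have := mmtWeight_pos (θ := θ) (γ := γ) hv
          positivity
      _ = _ := by ring
  rcases le_or_gt (u * ω) 1 with h | h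
  · rw [inv_mmtWeight_of_le_one hv h]
    calc _ = (u * ω) ^ (2*β + 2 + θ + θ) := by
          rw [Real.rpow_add hv (2*β + 2 + θ), Real.rpow_add hv (2*β + 2)]; ring
      _ ≤ 1 := Real.rpow_le_one hv.le h (by linarith)
      _ = 2 ^ (1 + δ) * 2 ^ (-δ - 1) := htwo.symm
      _ ≤ _ := by
          gcongr 2 ^ (1 + δ) * ?_
          exact Real.rpow_le_rpow_of_nonpos (by linarith) (by linarith) (by linarith)
  · rw [inv_mmtWeight_of_one_lt h]
    calc _ = (u * ω) ^ (2*β + 2 + -γ + -γ) := by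
          rw [Real.rpow_add hv (2*β + 2 + -γ), Real.rpow_add hv (2*β + 2)]; ring
      _ ≤ (u * ω) ^ (-δ - 1) := Real.rpow_le_rpow_of_exponent_le h.le (by linarith)
      _ = 2 ^ (1 + δ) * (2 * (u * ω)) ^ (-δ - 1) := by
          rw [Real.mul_rpow (by norm_num) hv.le, ← mul_assoc, htwo, one_mul]
      _ ≤ _ := by
          gcongr 2 ^ (1 + δ) * ?_
          exact Real.rpow_le_rpow_of_nonpos (by linarith) (by linarith) (by linarith)

lemma continuousOn_profile {δ ω : ℝ} (hω : 0 < ω) :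
    ContinuousOn (fun u : ℝ => ω * (1 + ω * u) ^ (-δ - 1)) (Set.Icc 0 1) := by
  refine continuousOn_const.mul (ContinuousOn.rpow_const (by fun_prop) fun u hu => Or.inl ?_)
  have := mul_nonneg hω.le hu.1
  positivity

lemma integral_profile_le {δ ω : ℝ} (hδ : 0 < δ) (hω : 0 < ω) :
    ∫ u in Set.Ioo (0:ℝ) 1, ω * (1 + ω * u) ^ (-δ - 1) ≤ 1 / δ := by
  have hderiv : ∀ u ∈ Set.uIcc (0:ℝ) 1,
      HasDerivAt (fun u : ℝ => -(1 / δ) * (1 + ω * u) ^ (-δ)) (ω * (1 + ω * u) ^ (-δ - 1)) u := by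
    intro u hu
    rw [Set.uIcc_of_le zero_le_one] at hu
    have hpos : 1 + ω * u ≠ 0 := by
      have := mul_nonneg hω.le hu.1
      positivity
    have hlin : HasDerivAt (fun u : ℝ => 1 + ω * u) ω u := by
      simpa using ((hasDerivAt_id u).const_mul ω).const_add 1
    refine ((hlin.rpow_const (p := -δ) (Or.inl hpos)).const_mul (-(1 / δ))).congr_deriv ?_
    field_simp
  rw [← integral_Ioc_eq_integral_Ioo, ← intervalIntegral.integral_of_le zero_le_one,
    intervalIntegral.integral_eq_sub_of_hasDerivAt hderiv]
  · have : 0 ≤ 1 / δ * (1 + ω) ^ (-δ) := by positivity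
    simp only [mul_one, mul_zero, add_zero, Real.one_rpow]
    linarith
  · refine ContinuousOn.intervalIntegrable ?_
    rw [Set.uIcc_of_le zero_le_one]
    exact continuousOn_profile hω

lemma integrableOn_profile {δ ω : ℝ} (hω : 0 < ω) :
    IntegrableOn (fun u : ℝ => ω * (1 + ω * u) ^ (-δ - 1)) (Set.Ioo 0 1) :=
  (continuousOn_profile hω).integrableOn_Icc.mono_set Set.Ioo_subset_Icc_self

lemma setIntegral_Ioo_le_of_le {f g : ℝ → ℝ} (hg : IntegrableOn g (Set.Ioo 0 1))
    (hf : ∀ u ∈ Set.Ioo (0:ℝ) 1, 0 ≤ f u) (hfg : ∀ u ∈ Set.Ioo (0:ℝ) 1, f u ≤ g u) :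
    ∫ u in Set.Ioo (0:ℝ) 1, f u ≤ ∫ u in Set.Ioo (0:ℝ) 1, g u := by
  refine integral_mono_of_nonneg ?_ hg ?_
  · filter_upwards [ae_restrict_mem measurableSet_Ioo] with u hu using hf u hu
  · filter_upwards [ae_restrict_mem measurableSet_Ioo] with u hu using hfg u hu

lemma kernel_prefactor_le {β u : ℝ} (hβ₁ : -1/2 ≤ β) (hβ₂ : β ≤ 0) (hu : 0 < u) (hu1 : u ≤ 1) :
    u ^ (2*β + 2) * (u + 1) ^ (2*β + 2) / (1 + u + u^2) ^ (3*β + 4) ≤ 4 * u ^ (2*β + 2) := by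
  have hden : 1 ≤ (1 + u + u^2) ^ (3*β + 4) :=
    Real.one_le_rpow (by nlinarith) (by linarith)
  have hnum : (u + 1) ^ (2*β + 2) ≤ 4 :=
    calc (u + 1) ^ (2*β + 2) ≤ (u + 1) ^ (2 : ℝ) :=
          Real.rpow_le_rpow_of_exponent_le (by linarith) (by linarith)
      _ = (u + 1) ^ 2 := Real.rpow_two _
      _ ≤ 4 := by nlinarith
  calc _ ≤ u ^ (2*β + 2) * (u + 1) ^ (2*β + 2) := div_le_self (by positivity) hden
    _ ≤ u ^ (2*β + 2) * 4 := by gcongr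
    _ = _ := mul_comm _ _

/-- If all three contracted values are controlled by `K` times reference values, then so is the
four-term sum with all plus signs. -/
lemma four_term_sum_le {K A B D n N : ℝ} (hK : 1 ≤ K) (hB : 0 ≤ B) (hD : 0 ≤ D)
    (hn : 0 ≤ n) (hN : 0 ≤ N) (hAn : A ≤ K * n) (hBN : B ≤ K * N) (hDN : D ≤ K * N) :
    A * B * D + A * B * n + A * n * D + n * B * D ≤
      2 * K ^ 3 * (n * (N * N) + n * (N * n)) := by
  have hnK : n ≤ K * n := le_mul_of_one_le_left hn hK
  calc A * B * D + A * B * n + A * n * D + n * B * D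
      ≤ (K * n) * (K * N) * (K * N) + (K * n) * (K * N) * (K * n) +
          (K * n) * (K * n) * (K * N) + (K * n) * (K * N) * (K * N) := by gcongr
    _ = _ := by ring

lemma collision_integrand_le {β θ γ δ u ω : ℝ} (hβ₁ : -1/2 ≤ β) (hβ₂ : β ≤ 0) (hδ : 0 < δ)
    (hγ : 4*β + 4 + δ ≤ 2*γ) (hθ : -2*β - 1 < θ) (hu : 0 < u) (hu1 : u < 1) (hω : 0 < ω) :
    mmtWeight θ γ ω * ω ^ (4*β + 3) *
      (u ^ (2*β + 2) * (u + 1) ^ (2*β + 2) / (1 + u + u^2) ^ (3*β + 4) *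
          ((mmtWeight θ γ ((1 + u) / (1 + u + u^2) * ω))⁻¹ *
              (mmtWeight θ γ (u * (1 + u) / (1 + u + u^2) * ω))⁻¹ *
              (mmtWeight θ γ (u / (1 + u + u^2) * ω))⁻¹ +
            (mmtWeight θ γ ((1 + u) / (1 + u + u^2) * ω))⁻¹ *
              (mmtWeight θ γ (u * (1 + u) / (1 + u + u^2) * ω))⁻¹ *
              (mmtWeight θ γ ω)⁻¹ +
            (mmtWeight θ γ ((1 + u) / (1 + u + u^2) * ω))⁻¹ *
              (mmtWeight θ γ ω)⁻¹ *
              (mmtWeight θ γ (u / (1 + u + u^2) * ω))⁻¹ +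
            (mmtWeight θ γ ω)⁻¹ *
              (mmtWeight θ γ (u * (1 + u) / (1 + u + u^2) * ω))⁻¹ *
              (mmtWeight θ γ (u / (1 + u + u^2) * ω))⁻¹)) ≤
      8 * (3 ^ (|θ| + γ)) ^ 3 * (2 + 2 ^ (1 + δ) * (ω * (1 + ω * u) ^ (-δ - 1))) := by
  have hγ0 : 0 ≤ γ := by linarith
  have hden : 0 < 1 + u + u^2 := by positivity
  have hv : 0 < u * ω := mul_pos hu hω
  have hm : 0 < mmtWeight θ γ ω := mmtWeight_pos hω
  have hN : 0 < mmtWeight θ γ (u * ω) := mmtWeight_pos hv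
  have hA : 0 < mmtWeight θ γ ((1 + u) / (1 + u + u^2) * ω) := mmtWeight_pos (by positivity)
  have hB : 0 < mmtWeight θ γ (u * (1 + u) / (1 + u + u^2) * ω) := mmtWeight_pos (by positivity)
  have hD : 0 < mmtWeight θ γ (u / (1 + u + u^2) * ω) := mmtWeight_pos (by positivity)
  have ha : 1 / 3 ≤ (1 + u) / (1 + u + u^2) := by
    rw [div_le_div_iff₀ (by norm_num) hden]; nlinarith
  have ha1 : (1 + u) / (1 + u + u^2) ≤ 1 := by
    rw [div_le_one hden]; nlinarith
  have hd : 1 / 3 ≤ 1 / (1 + u + u^2) := by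
    rw [div_le_div_iff₀ (by norm_num) hden]; nlinarith
  have hd1 : 1 / (1 + u + u^2) ≤ 1 := by
    rw [div_le_one hden]; nlinarith
  have hAle := inv_mmtWeight_mul_le (θ := θ) hγ0 ha ha1 hω
  have hBle := inv_mmtWeight_mul_le (θ := θ) hγ0 ha ha1 hv
  have hDle := inv_mmtWeight_mul_le (θ := θ) hγ0 hd hd1 hv
  rw [show (1 + u) / (1 + u + u^2) * (u * ω) = u * (1 + u) / (1 + u + u^2) * ω by ring] at hBle
  rw [show 1 / (1 + u + u^2) * (u * ω) = u / (1 + u + u^2) * ω by ring] at hDle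
  have hK : (1 : ℝ) ≤ 3 ^ (|θ| + γ) := Real.one_le_rpow (by norm_num) (by positivity)
  have hsum := four_term_sum_le hK (inv_pos.2 hB).le (inv_pos.2 hD).le
    (inv_pos.2 hm).le (inv_pos.2 hN).le hAle hBle hDle
  have hpre := kernel_prefactor_le hβ₁ hβ₂ hu hu1.le
  have hcross := kernel_mul_inv_mmtWeight_mul_le_one (by linarith : 2*β + 2 < γ) hθ
    hu hu1.le hω
  have hsq := kernel_mul_inv_mmtWeight_sq_le hβ₁ hβ₂ hδ hγ hθ hu hu1.le hω
  set K : ℝ := 3 ^ (|θ| + γ)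
  set m := mmtWeight θ γ ω
  set N := (mmtWeight θ γ (u * ω))⁻¹
  calc _ ≤ m * ω ^ (4*β + 3) * ((4 * u ^ (2*β + 2)) *
          (2 * K ^ 3 * (m⁻¹ * (N * N) + m⁻¹ * (N * m⁻¹)))) := by
        refine mul_le_mul_of_nonneg_left (mul_le_mul hpre hsum ?_ ?_) ?_ <;> positivity
    _ = 8 * K ^ 3 * (ω ^ (4*β + 3) * u ^ (2*β + 2) * (N * N) +
          ω ^ (4*β + 3) * u ^ (2*β + 2) * (N * m⁻¹)) := by
        field_simp
        ring
    _ ≤ _ := by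
        gcongr 8 * K ^ 3 * ?_
        linarith

theorem stmt_19 (β θ γ : ℝ)
    (hβ₁ : -1/2 ≤ β) (hβ₂ : β ≤ 0) (hγ : 2*β + 2 < γ) (hθ : -2*β - 1 < θ)
    (h1 : 0 < 2*β + 3 + θ) (h2 : 0 < 2*β + 3 + 2*θ) (h3 : 0 ≤ 4*β + 3 + 2*θ) :
    -- uniform boundedness of the weighted `F₁`-term over all frequencies
    (∃ C : ℝ, 0 < C ∧ ∀ ω : ℝ, 0 < ω →
      mmtWeight θ γ ω * (ω ^ (4*β + 3) * ∫ u in Set.Ioo (0:ℝ) 1,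
        u ^ (2*β + 2) * (u + 1) ^ (2*β + 2) / (1 + u + u^2) ^ (3*β + 4) *
          ((mmtWeight θ γ ((1 + u) / (1 + u + u^2) * ω))⁻¹ *
              (mmtWeight θ γ (u * (1 + u) / (1 + u + u^2) * ω))⁻¹ *
              (mmtWeight θ γ (u / (1 + u + u^2) * ω))⁻¹ +
            (mmtWeight θ γ ((1 + u) / (1 + u + u^2) * ω))⁻¹ *
              (mmtWeight θ γ (u * (1 + u) / (1 + u + u^2) * ω))⁻¹ *
              (mmtWeight θ γ ω)⁻¹ +
            (mmtWeight θ γ ((1 + u) / (1 + u + u^2) * ω))⁻¹ *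
              (mmtWeight θ γ ω)⁻¹ *
              (mmtWeight θ γ (u / (1 + u + u^2) * ω))⁻¹ +
            (mmtWeight θ γ ω)⁻¹ *
              (mmtWeight θ γ (u * (1 + u) / (1 + u + u^2) * ω))⁻¹ *
              (mmtWeight θ γ (u / (1 + u + u^2) * ω))⁻¹))
        ≤ C) ∧
    -- the precise small-frequency estimate
    (∃ C : ℝ, 0 < C ∧ ∀ ω : ℝ, 0 < ω → ω ≤ 1 →
      ω ^ (-θ) * ω ^ (4*β + 3) *
          (∫ u in Set.Ioo (0:ℝ) 1,
            u ^ (2*β + 2) * (u ^ (2*θ) * ω ^ (3*θ) + u ^ θ * ω ^ (3*θ)))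
        ≤ C * ω ^ (4*β + 3 + 2*θ) ∧
      C * ω ^ (4*β + 3 + 2*θ) ≤ C) := by
  have hunit : IntegrableOn (fun _ : ℝ => (1 : ℝ)) (Set.Ioo 0 1) := by
    simp [IntegrableOn]
  constructor
  · obtain ⟨δ, hδ, hγδ⟩ : ∃ δ : ℝ, 0 < δ ∧ 4*β + 4 + δ ≤ 2*γ :=
      ⟨2*γ - 4*β - 4, by linarith, by linarith⟩
    refine ⟨8 * (3 ^ (|θ| + γ)) ^ 3 * (2 + 2 ^ (1 + δ) * (1 / δ)), by positivity,
      fun ω hω => ?_⟩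
    have hm : 0 < mmtWeight θ γ ω := mmtWeight_pos hω
    have hprofile := (integrableOn_profile (δ := δ) hω).const_mul (2 ^ (1 + δ))
    have hconst : IntegrableOn (fun _ : ℝ => (2 : ℝ)) (Set.Ioo 0 1) := by
      simp [IntegrableOn]
    rw [← mul_assoc, ← integral_const_mul]
    refine (setIntegral_Ioo_le_of_le ((hconst.add hprofile).const_mul
      (8 * (3 ^ (|θ| + γ)) ^ 3)) (fun u hu => ?_) fun u hu =>
        collision_integrand_le hβ₁ hβ₂ hδ hγδ hθ hu.1 hu.2 hω).trans ?_
    · have hu0 := hu.1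
      have hden : 0 < 1 + u + u^2 := by positivity
      have hA : 0 < mmtWeight θ γ ((1 + u) / (1 + u + u^2) * ω) :=
        mmtWeight_pos (by positivity)
      have hB : 0 < mmtWeight θ γ (u * (1 + u) / (1 + u + u^2) * ω) :=
        mmtWeight_pos (by positivity)
      have hD : 0 < mmtWeight θ γ (u / (1 + u + u^2) * ω) := mmtWeight_pos (by positivity)
      positivity
    · rw [integral_const_mul]
      gcongr 8 * (3 ^ (|θ| + γ)) ^ 3 * ?_
      simp only [Pi.add_apply]
      rw [integral_add hconst hprofile, integral_const_mul]
      gcongr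
      · simp
      · exact integral_profile_le hδ hω
  · refine ⟨2, two_pos, fun ω hω hω1 => ⟨?_, ?_⟩⟩
    · have hint : ∫ u in Set.Ioo (0:ℝ) 1,
          u ^ (2*β + 2) * (u ^ (2*θ) * ω ^ (3*θ) + u ^ θ * ω ^ (3*θ)) ≤ 2 * ω ^ (3*θ) := by
        refine (setIntegral_Ioo_le_of_le (hunit.const_mul (2 * ω ^ (3*θ))) (fun u hu => ?_)
          fun u hu => ?_).trans (by simp)
        · have := hu.1
          positivity
        · have h₁ : u ^ (2*β + 2 + 2*θ) ≤ 1 := Real.rpow_le_one hu.1.le hu.2.le (by linarith)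
          have h₂ : u ^ (2*β + 2 + θ) ≤ 1 := Real.rpow_le_one hu.1.le hu.2.le (by linarith)
          rw [Real.rpow_add hu.1] at h₁ h₂
          have hω3 : 0 ≤ ω ^ (3*θ) := by positivity
          nlinarith
      calc _ ≤ ω ^ (-θ) * ω ^ (4*β + 3) * (2 * ω ^ (3*θ)) := by gcongr
        _ = 2 * ω ^ (4*β + 3 + 2*θ) := by
          rw [show 4*β + 3 + 2*θ = -θ + (4*β + 3) + 3*θ by ring,
            Real.rpow_add hω (-θ + (4*β + 3)), Real.rpow_add hω (-θ)]
          ring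
    · have := Real.rpow_le_one hω.le hω1 h3
      linarith
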